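/- arXiv:1903.00222 — 2 statements merged into one kernel-verified Lean document; each statement's English description precedes it below -/
import Mathlib

section
/- Let T = (Q, Σ, δ) be an S-automaton and let 𝐏 ⊆ Q⁺ be a finite set of nonempty state sequences. The subsemigroup of S(T) generated by {𝐩∘ ∣ 𝐩 ∈ 𝐏} is infinite if and only if there is an ω-word ξ ∈ Σ^ω whose orbit 𝐏*∘ξ = {𝐩_n⋯𝐩_1∘ξ ∣ n ∈ ℕ, 𝐩_1,…,𝐩_n ∈ 𝐏, 𝐩_n⋯𝐩_1∘ defined on ξ} under the subsemigroup's action is infinite. -/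
/- Common framework for automaton semigroups acting on finite and infinite words.

An S-automaton over states `Q` and alphabet `A` is given by a partial deterministic
transition function `δ : Q → A → Option (A × Q)` (with `δ q a = some (b, p)` encoding
the transition `q –a/b→ p`). -/

namespace AutOrbit

variable {Q A : Type*}

/-- The partial action `q∘` of a single state on a finite word. -/
def stateAct (δ : Q → A → Option (A × Q)) : Q → List A → Option (List A)
  | _, [] => some []
  | q, a :: u => (δ q a).bind fun bp => (stateAct δ bp.2 u).map fun v => bp.1 :: v

/-- The partial action `𝐪∘` of a state sequence `𝐪 = q_n … q_1` (written left-to-right,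
head of the list is `q_n`; the rightmost state `q_1` is applied first). -/
def seqAct (δ : Q → A → Option (A × Q)) (l : List Q) (u : List A) : Option (List A) :=
  l.foldr (fun q acc => acc.bind (stateAct δ q)) (some u)

/-- The length-`n` prefix of an ω-word. -/
def pre (ξ : ℕ → A) (n : ℕ) : List A := List.ofFn fun i : Fin n => ξ i

/-- The `L`-orbit `L∘u` of a finite word `u`. -/
def orbit (δ : Q → A → Option (A × Q)) (L : Set (List Q)) (u : List A) : Set (List A) :=
  {v | ∃ l ∈ L, seqAct δ l u = some v}

/-- The `L`-orbit `L∘ξ` of an ω-word `ξ`: all ω-words `η` such that some `𝐪 ∈ L` is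
defined on `ξ` with `𝐪∘ξ = η` (i.e. `𝐪∘` maps every prefix of `ξ` to the
corresponding prefix of `η`). -/
def omegaOrbit (δ : Q → A → Option (A × Q)) (L : Set (List Q)) (ξ : ℕ → A) :
    Set (ℕ → A) :=
  {η | ∃ l ∈ L, ∀ n, seqAct δ l (pre ξ n) = some (pre η n)}

/-- The set of partial maps `L∘ = {𝐪∘ ∣ 𝐪 ∈ L}`. -/
def mapsOf (δ : Q → A → Option (A × Q)) (L : Set (List Q)) :
    Set (List A → Option (List A)) :=
  {f | ∃ l ∈ L, f = seqAct δ l}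

/-- `L ⊆ F*` is suffix-closed over `F`: every `𝐪 ∈ L` factorizes into factors from `F`
such that every suffix (as a word over the alphabet `F`) of the factorization is
again in `L`. -/
def SuffixClosedOver (F L : Set (List Q)) : Prop :=
  ∀ l ∈ L, ∃ fs : List (List Q),
    (∀ f ∈ fs, f ∈ F) ∧ fs.flatten = l ∧ ∀ i, (fs.drop i).flatten ∈ L

/-- `L` is finitely suffix-closed: suffix-closed over some finite nonempty `F ⊆ Q*`. -/
def FinitelySuffixClosed (L : Set (List Q)) : Prop :=
  ∃ F : Set (List Q), F.Finite ∧ F.Nonempty ∧ SuffixClosedOver F L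

/-- `u` has infinite potential w.r.t. `δ` and `L`: the orbit sizes `|L∘ux|` are unbounded. -/
def InfinitePotential (δ : Q → A → Option (A × Q)) (L : Set (List Q)) (u : List A) : Prop :=
  ∀ C : ℕ, ∃ x : List A, C < (orbit δ L (u ++ x)).ncard

/-- The `i`-th power `𝐪^i` of a state sequence. -/
def listPow (l : List Q) (i : ℕ) : List Q := (List.replicate i l).flatten

/-- `𝐪∘` has torsion: two distinct positive powers induce the same partial map. -/
def HasTorsion (δ : Q → A → Option (A × Q)) (l : List Q) : Prop :=
  ∃ i j : ℕ, 1 ≤ i ∧ 1 ≤ j ∧ i ≠ j ∧ seqAct δ (listPow l i) = seqAct δ (listPow l j)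

/-- The automaton is complete: `δ` is total. -/
def Complete (δ : Q → A → Option (A × Q)) : Prop := ∀ q a, (δ q a).isSome

/-- The automaton is invertible: for every state, the letter-to-output-letter map is a
bijection of the alphabet (each output letter is produced by exactly one input letter). -/
def Invertible (δ : Q → A → Option (A × Q)) : Prop :=
  ∀ q b, ∃! a, ∃ p, δ q a = some (b, p)

/-- A G-automaton: a complete invertible S-automaton. -/
def GAutomaton (δ : Q → A → Option (A × Q)) : Prop := Complete δ ∧ Invertible δ

/-- Reversibility: for every input letter `a` and target state `p` there is at most one
transition `q –a/b→ p`. -/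
def Reversible (δ : Q → A → Option (A × Q)) : Prop :=
  ∀ a p q₁ b₁ q₂ b₂, δ q₁ a = some (b₁, p) → δ q₂ a = some (b₂, p) → q₁ = q₂

/-- Reversibility of the inverse automaton: for every output letter `b` and target
state `p` there is at most one transition `q –a/b→ p`. -/
def InvReversible (δ : Q → A → Option (A × Q)) : Prop :=
  ∀ b p q₁ a₁ q₂ a₂, δ q₁ a₁ = some (b, p) → δ q₂ a₂ = some (b, p) → q₁ = q₂ ∧ a₁ = a₂

/-- Bi-reversibility: the automaton and its inverse automaton are both reversible. -/
def BiReversible (δ : Q → A → Option (A × Q)) : Prop := Reversible δ ∧ InvReversible δ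

/-- The dual automaton `∂T`: states are letters, letters are states; it has a transition
`a –q/p→ b` for every transition `q –a/b→ p` of `T`. -/
def dual (δ : Q → A → Option (A × Q)) : A → Q → Option (Q × A) :=
  fun a q => (δ q a).map fun bp => (bp.2, bp.1)

/-- Adjacency of states in the underlying undirected graph of the automaton. -/
def Adj (δ : Q → A → Option (A × Q)) (q p : Q) : Prop :=
  (∃ a b, δ q a = some (b, p)) ∨ (∃ a b, δ p a = some (b, q))

/-- `P` is (the state set of) a connected component of the automaton. -/
def IsComponent (δ : Q → A → Option (A × Q)) (P : Set Q) : Prop :=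
  ∃ q, P = {p | Relation.ReflTransGen (Adj δ) q p}

/-- The sub-automaton induced on `P` (with all transitions among states of `P`)
is reversible. -/
def SubReversible (δ : Q → A → Option (A × Q)) (P : Set Q) : Prop :=
  ∀ a : A, ∀ p ∈ P, ∀ q₁ b₁ q₂ b₂, q₁ ∈ P → q₂ ∈ P →
    δ q₁ a = some (b₁, p) → δ q₂ a = some (b₂, p) → q₁ = q₂

/-- The inverse of the sub-automaton induced on `P` is reversible. -/
def SubInvReversible (δ : Q → A → Option (A × Q)) (P : Set Q) : Prop :=
  ∀ b : A, ∀ p ∈ P, ∀ q₁ a₁ q₂ a₂, q₁ ∈ P → q₂ ∈ P →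
    δ q₁ a₁ = some (b, p) → δ q₂ a₂ = some (b, p) → q₁ = q₂ ∧ a₁ = a₂

/-- The sub-automaton induced on `P` is bi-reversible. -/
def SubBiReversible (δ : Q → A → Option (A × Q)) (P : Set Q) : Prop :=
  SubReversible δ P ∧ SubInvReversible δ P

/-- For a complete automaton, the (total) action of a state on a finite word. -/
noncomputable def totAct (δ : Q → A → Option (A × Q)) (q : Q) (u : List A) : List A :=
  (stateAct δ q u).getD u

/-- The action of a state of the automaton (`Sum.inl`) or of its inverse automaton
(`Sum.inr`): for a G-automaton, `totAct δ q` is a bijection of `Σ*` and the inverse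
state `q̄` acts as its inverse bijection. -/
noncomputable def gAct (δ : Q → A → Option (A × Q)) : Q ⊕ Q → List A → List A
  | Sum.inl q => totAct δ q
  | Sum.inr q => Function.invFun (totAct δ q)

/-- Action of a sequence over `Q ⊔ Q̄` (rightmost entry applied first). -/
noncomputable def gSeqAct (δ : Q → A → Option (A × Q)) (l : List (Q ⊕ Q)) (u : List A) :
    List A :=
  l.foldr (fun s v => gAct δ s v) u

/-- The automaton group `G(T) = {𝐪∘ ∣ 𝐪 ∈ (Q ⊔ Q̄)⁺}` as a set of maps on `Σ*`. -/
def autGroup (δ : Q → A → Option (A × Q)) : Set (List A → List A) :=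
  {f | ∃ l : List (Q ⊕ Q), l ≠ [] ∧ f = gSeqAct δ l}

/-- The ultimately periodic ω-word `u (a v)^ω`. -/
def ultPer (u : List A) (a : A) (v : List A) (n : ℕ) : A :=
  if h : n < u.length then u.get ⟨n, h⟩
  else (a :: v).get ⟨(n - u.length) % (a :: v).length, Nat.mod_lt _ (by simp)⟩

/-- Run of a single state on a word, returning the output word and the final state. -/
def runState (δ : Q → A → Option (A × Q)) : Q → List A → Option (List A × Q)
  | q, [] => some ([], q)
  | q, a :: u => (δ q a).bind fun bp =>
      (runState δ bp.2 u).map fun vr => (bp.1 :: vr.1, vr.2)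

/-- Run of a state sequence `𝐪` on a word `u`, returning the output word `𝐪∘u` and the
residual state sequence `𝐪·u` (the dual action). -/
def runSeq (δ : Q → A → Option (A × Q)) : List Q → List A → Option (List A × List Q)
  | [], u => some (u, [])
  | q :: l, u => (runSeq δ l u).bind fun vr =>
      (runState δ q vr.1).map fun wp => (wp.1, wp.2 :: vr.2)

/-- Nodes of the `L`-orbital transducer over `F` of `u`: words reached from `u` along a
path of `F`-labeled edges whose reverse label (a word over `F`) lies in `L`. -/
def transNodes (δ : Q → A → Option (A × Q)) (F L : Set (List Q)) (u : List A) :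
    Set (List A) :=
  {v | ∃ fs : List (List Q), (∀ f ∈ fs, f ∈ F) ∧ fs.flatten ∈ L ∧
        ∃ r, runSeq δ fs.flatten u = some (v, r)}

/-- Edges of the `L`-orbital transducer over `F` of `u`: an edge `v –𝐩/𝐨→ w` with
`𝐩 ∈ F`, input label `𝐩`, output label `𝐨 = 𝐩·v`, lying on a path from `u` whose
reverse label is in `L`. -/
def transEdge (δ : Q → A → Option (A × Q)) (F L : Set (List Q)) (u : List A)
    (v : List A) (p o : List Q) (w : List A) : Prop :=
  p ∈ F ∧ ∃ fs : List (List Q), (∀ f ∈ fs, f ∈ F) ∧ (p :: fs).flatten ∈ L ∧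
    (∃ r, runSeq δ fs.flatten u = some (v, r)) ∧ runSeq δ p v = some (w, o)

/-- Isomorphism of the `L`-orbital transducers over `F` of `u₁` and `u₂`: a bijection of
the node sets mapping `u₁` to `u₂` and preserving labeled edges in both directions. -/
def TransducerIso (δ : Q → A → Option (A × Q)) (F L : Set (List Q)) (u₁ u₂ : List A) :
    Prop :=
  ∃ φ : List A → List A,
    Set.BijOn φ (transNodes δ F L u₁) (transNodes δ F L u₂) ∧ φ u₁ = u₂ ∧
    ∀ v ∈ transNodes δ F L u₁, ∀ w ∈ transNodes δ F L u₁, ∀ p o : List Q,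
      (transEdge δ F L u₁ v p o w ↔ transEdge δ F L u₂ (φ v) p o (φ w))


section Runs

variable (δ : Q → A → Option (A × Q))

lemma stateAct_eq_map_runState (q : Q) (u : List A) :
    stateAct δ q u = (runState δ q u).map Prod.fst := by
  induction u generalizing q with
  | nil => simp [stateAct, runState]
  | cons a u ih =>
    cases h : δ q a <;> simp [stateAct, runState, h, ih, Function.comp_def]

lemma seqAct_eq_map_runSeq (l : List Q) (u : List A) :
    seqAct δ l u = (runSeq δ l u).map Prod.fst := by
  induction l with
  | nil => simp [seqAct, runSeq]
  | cons q l ih =>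
    have h : seqAct δ (q :: l) u = (seqAct δ l u).bind (stateAct δ q) := rfl
    rw [h, ih]
    cases hr : runSeq δ l u <;>
      simp [runSeq, hr, stateAct_eq_map_runState, Function.comp_def]

lemma runState_append (q : Q) (u z : List A) :
    runState δ q (u ++ z) = (runState δ q u).bind fun vr =>
      (runState δ vr.2 z).map fun ws => (vr.1 ++ ws.1, ws.2) := by
  induction u generalizing q with
  | nil => simp [runState]
  | cons a u ih =>
    cases h : δ q a with
    | none => simp [runState, h]
    | some bp =>
      cases h' : runState δ bp.2 u <;>
        simp [runState, h, h', ih, Function.comp_def]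

lemma runSeq_append_word (l : List Q) (u z : List A) :
    runSeq δ l (u ++ z) = (runSeq δ l u).bind fun vr =>
      (runSeq δ vr.2 z).map fun ws => (vr.1 ++ ws.1, ws.2) := by
  induction l with
  | nil => simp [runSeq]
  | cons q l ih =>
    cases h : runSeq δ l u with
    | none => simp [runSeq, h, ih]
    | some vr =>
      cases h' : runSeq δ vr.2 z with
      | none => cases h'' : runState δ q vr.1 <;> simp [runSeq, h, h', h'', ih]
      | some ws =>
        cases h'' : runState δ q vr.1 <;>
          simp [runSeq, h, h', h'', ih, runState_append, Function.comp_def]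

lemma runSeq_append_seq (l₁ l₂ : List Q) (u : List A) :
    runSeq δ (l₁ ++ l₂) u = (runSeq δ l₂ u).bind fun vr =>
      (runSeq δ l₁ vr.1).map fun ws => (ws.1, ws.2 ++ vr.2) := by
  induction l₁ with
  | nil => simp [runSeq]
  | cons q l ih =>
    cases h : runSeq δ l₂ u with
    | none => simp [runSeq, h, ih]
    | some vr =>
      cases h' : runSeq δ l vr.1 with
      | none => simp [runSeq, h, h', ih]
      | some ws =>
        cases h'' : runState δ q ws.1 <;> simp [runSeq, h, h', h'', ih]

lemma length_of_runState {q p : Q} {u v : List A} (h : runState δ q u = some (v, p)) :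
    v.length = u.length := by
  induction u generalizing q v with
  | nil => simp [runState] at h; simp [← h.1]
  | cons a u ih =>
    simp only [runState, Option.bind_eq_some_iff, Option.map_eq_some_iff] at h
    obtain ⟨bp, -, vr, hvr, h⟩ := h
    obtain ⟨rfl, rfl⟩ := Prod.mk.inj h
    simp [ih hvr]

lemma length_of_runSeq {l r : List Q} {u v : List A} (h : runSeq δ l u = some (v, r)) :
    v.length = u.length ∧ r.length = l.length := by
  induction l generalizing v r with
  | nil => simp [runSeq] at h; simp [← h.1, ← h.2]
  | cons q l ih =>
    simp only [runSeq, Option.bind_eq_some_iff, Option.map_eq_some_iff] at h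
    obtain ⟨vr, hvr, wp, hwp, h⟩ := h
    obtain ⟨rfl, rfl⟩ := Prod.mk.inj h
    simp [(ih hvr).1, (ih hvr).2, length_of_runState δ hwp]

lemma length_of_seqAct {l : List Q} {u v : List A} (h : seqAct δ l u = some v) :
    v.length = u.length := by
  rw [seqAct_eq_map_runSeq, Option.map_eq_some_iff] at h
  obtain ⟨⟨v, r⟩, hvr, rfl⟩ := h
  exact (length_of_runSeq δ hvr).1

lemma seqAct_append_seq (l₁ l₂ : List Q) (u : List A) :
    seqAct δ (l₁ ++ l₂) u = (seqAct δ l₂ u).bind (seqAct δ l₁) := by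
  cases h : runSeq δ l₂ u <;>
    simp [seqAct_eq_map_runSeq, runSeq_append_seq, h, Function.comp_def]

lemma seqAct_append_word (l : List Q) (u z : List A) :
    seqAct δ l (u ++ z) = (runSeq δ l u).bind fun vr => (seqAct δ vr.2 z).map (vr.1 ++ ·) := by
  cases h : runSeq δ l u <;>
    simp [seqAct_eq_map_runSeq, runSeq_append_word, h, Function.comp_def]

lemma pre_succ (ξ : ℕ → A) (n : ℕ) : pre ξ (n + 1) = pre ξ n ++ [ξ n] := by
  rw [pre, List.ofFn_succ_last]
  rfl

lemma pre_prefix (ξ : ℕ → A) {m n : ℕ} (h : m ≤ n) : pre ξ m <+: pre ξ n := by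
  induction n, h using Nat.le_induction with
  | base => exact List.prefix_rfl
  | succ n _ ih => exact ih.trans ⟨[ξ n], (pre_succ ξ n).symm⟩

/-- If `𝐪∘` is defined on every prefix of an ω-word, then it is defined on the ω-word. -/
lemma exists_omega_image (l : List Q) (ξ : ℕ → A)
    (h : ∀ n, (seqAct δ l (pre ξ n)).isSome) :
    ∃ η : ℕ → A, ∀ n, seqAct δ l (pre ξ n) = some (pre η n) := by
  choose v hv using fun n => Option.isSome_iff_exists.1 (h n)
  have hlen : ∀ n, (v n).length = n := fun n => by
    simpa [pre] using length_of_seqAct δ (hv n)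
  have hsucc : ∀ n, ∃ a, v (n + 1) = v n ++ [a] := fun n => by
    have h₁ := hv (n + 1)
    rw [pre_succ, seqAct_append_word] at h₁
    simp only [Option.bind_eq_some_iff, Option.map_eq_some_iff] at h₁
    obtain ⟨vr, hvr, w, hw, hvw⟩ := h₁
    have h₂ := hv n
    rw [seqAct_eq_map_runSeq, hvr] at h₂
    obtain ⟨a, rfl⟩ := List.length_eq_one_iff.1 (by simpa using length_of_seqAct δ hw)
    exact ⟨a, by rw [← hvw, ← Option.some.inj h₂]⟩
  choose η hη using hsucc
  refine ⟨η, fun n => ?_⟩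
  rw [hv]
  congr 1
  induction n with
  | zero => simpa [pre] using hlen 0
  | succ n ih => rw [hη, ih, pre_succ]

end Runs

/-- The submonoid `𝐏*` of `Q*` generated by `𝐏`. -/
def factorStar (P : Set (List Q)) : Set (List Q) :=
  {l | ∃ fs : List (List Q), (∀ f ∈ fs, f ∈ P) ∧ fs.flatten = l}

lemma mem_factorStar_iff {P : Set (List Q)} {l : List Q} :
    l ∈ factorStar P ↔ ∃ fs : List P, fs.unattach.flatten = l := by
  constructor
  · rintro ⟨fs, hfs, rfl⟩
    lift fs to List P using hfs
    exact ⟨fs, rfl⟩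
  · rintro ⟨fs, rfl⟩
    exact ⟨fs.unattach, fun f hf => (List.mem_unattach.1 hf).1, rfl⟩

/-- The residual state sequences `𝐪·u` of all `𝐪 ∈ 𝐏*`, as a function of the factorization
of `𝐪` over `𝐏`. -/
def residual (δ : Q → A → Option (A × Q)) (P : Set (List Q)) (u : List A) (fs : List P) :
    Option (List Q) :=
  (runSeq δ (fs.unattach.flatten) u).map Prod.snd

/-- Follow a path, read from right to left, in a deterministic graph whose edges carry output
labels; returns the end node and the concatenated output. -/
def walk {N ι : Type*} (s : N → ι → Option (N × List Q)) (c : N) :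
    List ι → Option (N × List Q)
  | [] => some (c, [])
  | p :: fs => (walk s c fs).bind fun cr => (s cr.1 p).map fun dr => (dr.1, dr.2 ++ cr.2)

section Orbits

variable (δ : Q → A → Option (A × Q)) (P : Set (List Q))

lemma orbit_finite [Finite A] (L : Set (List Q)) (u : List A) : (orbit δ L u).Finite :=
  (List.finite_length_eq A u.length).subset fun _ ⟨_, _, h⟩ => length_of_seqAct δ h

lemma runSeq_fst_mem_orbit {fs : List P} {u : List A} {vr : List A × List Q}
    (h : runSeq δ (fs.unattach.flatten) u = some vr) : vr.1 ∈ orbit δ (factorStar P) u :=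
  ⟨_, mem_factorStar_iff.2 ⟨fs, rfl⟩, by simp [seqAct_eq_map_runSeq, h]⟩

/-- Words with orbits of bounded size have only finitely many residual functions. -/
lemma finite_residuals [Finite Q] [Finite A] (hP : P.Finite) (C : ℕ) :
    (residual δ P '' {u | (orbit δ (factorStar P) u).ncard ≤ C}).Finite := by
  have := hP.to_subtype
  let T : P → Set (Option (Fin (C + 1) × List Q)) := fun p =>
    insert none (some '' (Set.univ ×ˢ {r | r.length = p.1.length}))
  have hT : ∀ p, (T p).Finite := fun p =>
    ((Set.finite_univ.prod (List.finite_length_eq Q _)).image _).insert _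
  have hS : {s : Fin (C + 1) → P → Option (Fin (C + 1) × List Q) |
      ∀ c, s c ∈ {g | ∀ p, g p ∈ T p}}.Finite :=
    Set.Finite.pi' fun _ => Set.Finite.pi' hT
  refine ((hS.prod (Set.finite_univ (α := Fin (C + 1)))).image
    fun sc fs => (walk sc.1 sc.2 fs).map Prod.snd).subset ?_
  rintro _ ⟨u, hu, rfl⟩
  have hO := orbit_finite δ (factorStar P) u
  obtain ⟨e, -, he⟩ := hO.exists_injOn_of_encard_le (t := (Set.univ : Set (Fin (C + 1)))) (by
    rw [← hO.cast_ncard_eq, Set.encard_univ, ENat.card_eq_coe_fintype_card, Fintype.card_fin]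
    exact_mod_cast Nat.le_succ_of_le hu)
  let g := Function.invFunOn e (orbit δ (factorStar P) u)
  have hg : ∀ v ∈ orbit δ (factorStar P) u, g (e v) = v := he.leftInvOn_invFunOn
  let s : Fin (C + 1) → P → Option (Fin (C + 1) × List Q) := fun c p =>
    (runSeq δ p.1 (g c)).map (Prod.map e id)
  have hwalk : ∀ fs : List P, walk s (e u) fs =
      (runSeq δ (fs.unattach.flatten) u).map (Prod.map e id) := by
    intro fs
    induction fs with
    | nil => simp [walk, runSeq]
    | cons p fs ih =>
      cases h : runSeq δ (fs.unattach.flatten) u with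
      | none => simp [walk, ih, h, runSeq_append_seq]
      | some vr =>
        simp [walk, ih, h, runSeq_append_seq, s, hg _ (runSeq_fst_mem_orbit δ P h),
          Function.comp_def]
  refine ⟨(s, e u), ⟨fun c p => ?_, Set.mem_univ _⟩, ?_⟩
  · cases h : runSeq δ p.1 (g c) with
    | none => simp [s, T, h]
    | some vr => simp [s, T, h, (length_of_runSeq δ h).2]
  · funext fs
    simp [hwalk, residual, Function.comp_def]

lemma seqAct_concat (fs : List P) (u : List A) (a : A) :
    seqAct δ (fs.unattach.flatten) (u ++ [a]) =
      (seqAct δ (fs.unattach.flatten) u).bind fun v =>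
        ((residual δ P u fs).bind fun r => (seqAct δ r [a]).bind List.head?).map
          fun b => v ++ [b] := by
  cases h : runSeq δ (fs.unattach.flatten) u with
  | none => rw [seqAct_append_word, seqAct_eq_map_runSeq, h]; rfl
  | some vr =>
    rw [seqAct_append_word, seqAct_eq_map_runSeq, residual, h]
    cases h' : seqAct δ vr.2 [a] with
    | none => simp [h']
    | some w =>
      obtain ⟨b, rfl⟩ := List.length_eq_one_iff.1 (by simpa using length_of_seqAct δ h')
      simp [h']

lemma finite_mapsOf_of_bounded [Finite Q] [Finite A] (hP : P.Finite) (C : ℕ)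
    (hC : ∀ u, (orbit δ (factorStar P) u).ncard ≤ C) : (mapsOf δ (factorStar P)).Finite := by
  let R := residual δ P '' {u | (orbit δ (factorStar P) u).ncard ≤ C}
  have : Finite R := (finite_residuals δ P hP C).to_subtype
  let G : List P → R → A → Option A := fun fs ρ a =>
    (ρ.1 fs).bind fun r => (seqAct δ r [a]).bind List.head?
  let f : List P → List A → Option (List A) := fun fs => seqAct δ (fs.unattach.flatten)
  have hf : f.FactorsThrough G := by
    intro fs fs' h
    funext u
    induction u using List.reverseRecOn with
    | nil =>
      have hnil : ∀ l : List Q, seqAct δ l [] = some [] := fun l => by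
        induction l with
        | nil => rfl
        | cons q l ih =>
          have : seqAct δ (q :: l) [] = (seqAct δ l []).bind (stateAct δ q) := rfl
          simp [this, ih, stateAct]
      simp [f, hnil]
    | append_singleton u a ih =>
      have h' := congrFun (congrFun h ⟨_, u, hC u, rfl⟩) a
      simp only [f, G] at ih h' ⊢
      rw [seqAct_concat, seqAct_concat, ih, h']
  refine (Set.finite_range (Function.extend G f fun _ _ => none)).subset ?_
  rintro _ ⟨l, hl, rfl⟩
  obtain ⟨fs, rfl⟩ := mem_factorStar_iff.1 hl
  exact ⟨G fs, hf.extend_apply _ fs⟩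

/-- The images of `z` under the state sequences in the range of `ρ`. -/
def outputs (ρ : List P → Option (List Q)) (z : List A) : Set (List A) :=
  {w | ∃ fs r, ρ fs = some r ∧ seqAct δ r z = some w}

lemma outputs_finite [Finite A] (ρ : List P → Option (List Q)) (z : List A) :
    (outputs δ P ρ z).Finite :=
  (List.finite_length_eq A z.length).subset fun _ ⟨_, _, _, h⟩ => length_of_seqAct δ h

lemma ncard_orbit_append_le [Finite A] (u z : List A) :
    (orbit δ (factorStar P) (u ++ z)).ncard ≤
      (orbit δ (factorStar P) u).ncard * (outputs δ P (residual δ P u) z).ncard := by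
  rw [← Set.ncard_prod]
  have hfin := (orbit_finite δ (factorStar P) u).prod (outputs_finite δ P (residual δ P u) z)
  refine (Set.ncard_le_ncard ?_ (hfin.image fun vw => vw.1 ++ vw.2)).trans
    (Set.ncard_image_le hfin)
  rintro _ ⟨l, hl, h⟩
  obtain ⟨fs, rfl⟩ := mem_factorStar_iff.1 hl
  simp only [seqAct_append_word, Option.bind_eq_some_iff, Option.map_eq_some_iff] at h
  obtain ⟨vr, hvr, w, hw, rfl⟩ := h
  exact ⟨(vr.1, w), ⟨runSeq_fst_mem_orbit δ P hvr, fs, vr.2, by simp [residual, hvr], hw⟩, rfl⟩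

lemma ncard_outputs_le [Finite A] (u z : List A) :
    (outputs δ P (residual δ P u) z).ncard ≤ (orbit δ (factorStar P) (u ++ z)).ncard := by
  have hfin := orbit_finite δ (factorStar P) (u ++ z)
  refine (Set.ncard_le_ncard ?_ (hfin.image (List.drop u.length))).trans
    (Set.ncard_image_le hfin)
  rintro w ⟨fs, r, hr, hw⟩
  obtain ⟨⟨v, r⟩, hvr, rfl⟩ := Option.map_eq_some_iff.1 hr
  refine ⟨v ++ w, ⟨_, mem_factorStar_iff.2 ⟨fs, rfl⟩, ?_⟩, ?_⟩
  · simp_all [seqAct_append_word]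
  · simp [← (length_of_runSeq δ hvr).1]

variable {P} in
/-- A word of infinite potential extends to words of infinite potential with arbitrarily large
orbits. -/
lemma InfinitePotential.exists_extension [Finite Q] [Finite A] (hP : P.Finite) {u : List A}
    (hu : InfinitePotential δ (factorStar P) u) (C : ℕ) :
    ∃ x, InfinitePotential δ (factorStar P) (u ++ x) ∧
      C < (orbit δ (factorStar P) (u ++ x)).ncard := by
  by_contra! hC
  let R := residual δ P '' {u | (orbit δ (factorStar P) u).ncard ≤ C}
  have hR : R.Finite := finite_residuals δ P hP C
  have hb : ∀ (ρ : List P → Option (List Q)) (a : A), ∃ b : ℕ,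
      (∃ D, ∀ y, (outputs δ P ρ (a :: y)).ncard ≤ D) →
        ∀ y, (outputs δ P ρ (a :: y)).ncard ≤ b := fun ρ a => by
    by_cases h : ∃ D, ∀ y, (outputs δ P ρ (a :: y)).ncard ≤ D
    · exact ⟨h.choose, fun _ => h.choose_spec⟩
    · exact ⟨0, fun h' => absurd h' h⟩
  choose b hb using hb
  obtain ⟨B, hB⟩ := ((hR.prod (Set.finite_univ (α := A))).image fun ρa => b ρa.1 ρa.2).bddAbove
  have hbound : ∀ y x, InfinitePotential δ (factorStar P) (u ++ x) →
      (orbit δ (factorStar P) (u ++ x ++ y)).ncard ≤ max C (C * B) := by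
    intro y
    induction y with
    | nil => exact fun x hx => by simpa using Or.inl (hC x hx)
    | cons a y ih =>
      intro x hx
      by_cases hxa : InfinitePotential δ (factorStar P) (u ++ (x ++ [a]))
      · simpa using ih _ hxa
      · simp only [InfinitePotential, not_forall, not_exists, not_lt] at hxa
        obtain ⟨D, hD⟩ := hxa
        refine le_max_of_le_right ((ncard_orbit_append_le δ P _ _).trans
          (Nat.mul_le_mul (hC x hx) ((hb _ a ⟨D, fun y => ?_⟩ y).trans
            (hB ⟨(_, a), ⟨⟨_, hC x hx, rfl⟩, Set.mem_univ _⟩, rfl⟩))))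
        exact (ncard_outputs_le δ P _ _).trans (by simpa using hD y)
  obtain ⟨z, hz⟩ := hu (max C (C * B))
  exact absurd (hbound z [] (by simpa using hu)) (by simpa using hz)

lemma exists_omega_limit (u : ℕ → List A) (hu : ∀ k, u k <+: u (k + 1))
    (hlt : ∀ k, (u k).length < (u (k + 1)).length) :
    ∃ ξ : ℕ → A, ∀ k, pre ξ (u k).length = u k := by
  have hmono : ∀ {k m}, k ≤ m → u k <+: u m := fun {k m} h => by
    induction m, h using Nat.le_induction with
    | base => exact List.prefix_rfl
    | succ m _ ih => exact ih.trans (hu m)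
  have hlen : ∀ k, k ≤ (u k).length := fun _ => (strictMono_nat_of_lt_succ hlt).le_apply
  refine ⟨fun n => (u (n + 1))[n]'(hlen (n + 1)), fun k => ?_⟩
  refine List.ext_getElem (by simp [pre]) fun i h₁ h₂ => ?_
  simp only [pre, List.getElem_ofFn]
  rcases le_total (i + 1) k with h | h
  · exact (hmono h).getElem _
  · exact ((hmono h).getElem h₂).symm

variable {P} in
lemma InfinitePotential.exists_omega [Finite Q] [Finite A] (hP : P.Finite)
    (h : InfinitePotential δ (factorStar P) []) :
    ∃ ξ : ℕ → A, ∀ C, ∃ n ≥ C, C < (orbit δ (factorStar P) (pre ξ n)).ncard := by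
  choose x hx hlt using fun (u : {u // InfinitePotential δ (factorStar P) u}) C =>
    InfinitePotential.exists_extension δ hP u.2 C
  let u : ℕ → {u // InfinitePotential δ (factorStar P) u} := fun k =>
    Nat.rec ⟨[], h⟩ (fun k v => ⟨_, hx v (k + (orbit δ (factorStar P) v.1).ncard)⟩) k
  have hu : ∀ k, (u (k + 1)).1 =
      (u k).1 ++ x (u k) (k + (orbit δ (factorStar P) (u k).1).ncard) := fun _ => rfl
  have horb : ∀ k, k + (orbit δ (factorStar P) (u k).1).ncard <
      (orbit δ (factorStar P) (u (k + 1)).1).ncard := fun k => hlt _ _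
  have hlen : ∀ k, (u k).1.length < (u (k + 1)).1.length := fun k => by
    by_contra! hle
    have hk := horb k
    rw [hu, List.length_append] at hle
    have hnil : x (u k) (k + (orbit δ (factorStar P) (u k).1).ncard) = [] :=
      List.length_eq_zero_iff.1 (by omega)
    rw [hu, hnil, List.append_nil] at hk
    omega
  obtain ⟨ξ, hξ⟩ := exists_omega_limit (fun k => (u k).1) (fun k => ⟨_, (hu k).symm⟩) hlen
  refine ⟨ξ, fun C => ⟨(u (C + 1)).1.length, ?_, ?_⟩⟩
  · exact (Nat.le_succ C).trans ((strictMono_nat_of_lt_succ hlen).le_apply)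
  · have := horb C
    rw [show pre ξ (u (C + 1)).1.length = (u (C + 1)).1 from hξ (C + 1)]
    omega

variable {P} in
/-- If an ω-word has a finite orbit, then the orbits of its prefixes are bounded. -/
lemma ncard_orbit_pre_le (hP : P.Finite) {ξ : ℕ → A}
    (hξ : (omegaOrbit δ (factorStar P) ξ).Finite) :
    ∃ N, ∀ n ≥ N, (orbit δ (factorStar P) (pre ξ n)).ncard ≤
      (omegaOrbit δ (factorStar P) ξ).ncard := by
  have hm : ∀ (η : ℕ → A) (p : List Q), ∃ m, (seqAct δ p (pre η m)).isSome →
      ∀ n, (seqAct δ p (pre η n)).isSome := fun η p => by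
    by_cases h : ∀ n, (seqAct δ p (pre η n)).isSome
    · exact ⟨0, fun _ => h⟩
    · obtain ⟨m, hm⟩ := not_forall.1 h
      exact ⟨m, fun h' => absurd h' hm⟩
  choose m hm using hm
  obtain ⟨N, hN⟩ := ((hξ.prod hP).image fun ηp => m ηp.1 ηp.2).bddAbove
  refine ⟨N, fun n hn => ?_⟩
  have htotal : ∀ fs : List P, (seqAct δ (fs.unattach.flatten) (pre ξ n)).isSome →
      ∃ η : ℕ → A, ∀ k, seqAct δ (fs.unattach.flatten) (pre ξ k) = some (pre η k) := by
    intro fs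
    induction fs with
    | nil => exact fun _ => ⟨ξ, fun _ => rfl⟩
    | cons p fs ih =>
      intro h
      simp only [List.unattach_cons, List.flatten_cons, seqAct_append_seq] at h ⊢
      obtain ⟨η, hη⟩ := ih (by
        cases h' : seqAct δ (fs.unattach.flatten) (pre ξ n) <;> simp [h'] at h ⊢)
      have hmn : m η p ≤ n := (hN ⟨(η, p.1),
        ⟨⟨_, mem_factorStar_iff.2 ⟨fs, rfl⟩, hη⟩, p.2⟩, rfl⟩).trans hn
      simp only [hη, Option.bind_some] at h ⊢
      refine exists_omega_image δ p.1 η (hm η p ?_)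
      obtain ⟨t, ht⟩ := pre_prefix η hmn
      rw [← ht, seqAct_append_word] at h
      rw [seqAct_eq_map_runSeq]
      cases h' : runSeq δ p.1 (pre η (m η p)) <;> simp [h'] at h ⊢
  refine (Set.ncard_le_ncard ?_ (hξ.image fun η => pre η n)).trans (Set.ncard_image_le hξ)
  rintro v ⟨l, hl, hv⟩
  obtain ⟨fs, rfl⟩ := mem_factorStar_iff.1 hl
  obtain ⟨η, hη⟩ := htotal fs (by simp [hv])
  exact ⟨η, ⟨_, hl, hη⟩, Option.some.inj ((hη n).symm.trans hv)⟩

lemma omega_ext {η η' : ℕ → A} (h : ∀ n, pre η n = pre η' n) : η = η' := by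
  funext n
  have := h (n + 1)
  rw [pre_succ, pre_succ, h n] at this
  simpa using this

lemma omegaOrbit_finite_of_mapsOf_finite {L : Set (List Q)} (hL : (mapsOf δ L).Finite)
    (ξ : ℕ → A) : (omegaOrbit δ L ξ).Finite := by
  refine (hL.biUnion (t := fun f => {η | ∀ n, f (pre ξ n) = some (pre η n)})
    fun f _ => Set.Subsingleton.finite fun η hη η' hη' => omega_ext fun n =>
      Option.some.inj ((hη n).symm.trans (hη' n))).subset ?_
  rintro η ⟨l, hl, h⟩
  exact Set.mem_biUnion ⟨l, hl, rfl⟩ h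

end Orbits

/-- For a finite set `𝐏 ⊆ Q⁺` of nonempty state sequences, the
subsemigroup `𝐏⁺∘` of `S(T)` generated by `{𝐩∘ ∣ 𝐩 ∈ 𝐏}` is infinite iff there is an
ω-word `ξ` whose orbit `𝐏*∘ξ` is infinite. -/
theorem subsemigroup_infinite_iff_omegaOrbit_infinite {Q A : Type*} [Fintype Q]
    [Fintype A] [Nonempty A] (δ : Q → A → Option (A × Q))
    (P : Set (List Q)) (hPfin : P.Finite) (hPne : ∀ p ∈ P, p ≠ []) :
    (mapsOf δ {l : List Q | ∃ fs : List (List Q), fs ≠ [] ∧ (∀ f ∈ fs, f ∈ P) ∧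
        fs.flatten = l}).Infinite ↔
      ∃ ξ : ℕ → A, (omegaOrbit δ {l : List Q | ∃ fs : List (List Q),
        (∀ f ∈ fs, f ∈ P) ∧ fs.flatten = l} ξ).Infinite := by
  constructor
  · intro hinf
    have hstar : (mapsOf δ (factorStar P)).Infinite := by
      refine hinf.mono ?_
      rintro _ ⟨l, ⟨fs, -, hfs, hl⟩, rfl⟩
      exact ⟨l, ⟨fs, hfs, hl⟩, rfl⟩
    have hpot : InfinitePotential δ (factorStar P) [] := by
      intro C
      by_contra! hC
      exact hstar (finite_mapsOf_of_bounded δ P hPfin C hC)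
    obtain ⟨ξ, hξ⟩ := InfinitePotential.exists_omega δ hPfin hpot
    refine ⟨ξ, fun hfin => ?_⟩
    obtain ⟨N, hN⟩ := ncard_orbit_pre_le δ hPfin hfin
    obtain ⟨n, hn, hlt⟩ := hξ (max N (omegaOrbit δ (factorStar P) ξ).ncard)
    exact absurd (hN n (le_of_max_le_left hn)) (not_le.2 (lt_of_le_of_lt (le_max_right _ _) hlt))
  · rintro ⟨ξ, hξ⟩ hfin
    refine hξ (omegaOrbit_finite_of_mapsOf_finite δ (L := factorStar P)
      ((hfin.insert (seqAct δ [])).subset ?_) ξ)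
    rintro _ ⟨l, ⟨fs, hfs, hl⟩, rfl⟩
    by_cases h : fs = []
    · subst h hl
      exact Or.inl rfl
    · exact Or.inr ⟨l, ⟨fs, h, hfs, hl⟩, rfl⟩

end AutOrbit
end

section
/- Let C be a finite nonempty set of colors and let W ⊆ C⁴ be an SW-deterministic tile set. Then W admits a non-y-recurrent tiling of the first quadrant ℕ × ℕ if and only if for every height Y ∈ ℕ there is a width X ∈ ℕ such that W admits a non-y-recurrent tiling of the rectangle {0,…,X} × {0,…,Y}. -/
namespace WangTiling

/-- A Wang tile: a quadruple of colors (north, west, south, east). -/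
structure WangTile (C : Type*) where
  north : C
  west : C
  south : C
  east : C

/-- A tile set is SW-deterministic if every tile is uniquely determined by its south and
west colors. -/
def SWDeterministic {C : Type*} (W : Set (WangTile C)) : Prop :=
  ∀ t₁ ∈ W, ∀ t₂ ∈ W, t₁.south = t₂.south → t₁.west = t₂.west → t₁ = t₂

/-- `t` is a tiling of the rectangle `{0,…,X} × {0,…,Y}` by the tile set `W`: tiles in
range belong to `W`, and east/west resp. north/south colors of adjacent tiles match. -/
def IsRectTiling {C : Type*} (W : Set (WangTile C)) (X Y : ℕ)
    (t : ℕ → ℕ → WangTile C) : Prop :=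
  (∀ x ≤ X, ∀ y ≤ Y, t x y ∈ W) ∧
  (∀ x < X, ∀ y ≤ Y, (t x y).east = (t (x + 1) y).west) ∧
  (∀ x ≤ X, ∀ y < Y, (t x y).north = (t x (y + 1)).south)

/-- The horizontal color sequences `h_0, …, h_{Y+1}` of a tiling of
`{0,…,X} × {0,…,Y}`: the south colors of row `y` for `y ≤ Y`, and the north colors of
the top row for `y = Y + 1`. -/
def rectRow {C : Type*} (X Y : ℕ) (t : ℕ → ℕ → WangTile C) (y : ℕ) : List C :=
  List.ofFn fun x : Fin (X + 1) => if y ≤ Y then (t x y).south else (t x Y).north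

/-- A rectangle tiling is non-y-recurrent if its horizontal color sequences
`h_0, …, h_{Y+1}` are pairwise distinct. -/
def RectNonYRecurrent {C : Type*} (X Y : ℕ) (t : ℕ → ℕ → WangTile C) : Prop :=
  ∀ y₁ ≤ Y + 1, ∀ y₂ ≤ Y + 1, y₁ ≠ y₂ → rectRow X Y t y₁ ≠ rectRow X Y t y₂

/-- `t` is a tiling of the first quadrant `ℕ × ℕ` by the tile set `W`. -/
def IsQuadTiling {C : Type*} (W : Set (WangTile C)) (t : ℕ → ℕ → WangTile C) : Prop :=
  (∀ x y : ℕ, t x y ∈ W) ∧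
  (∀ x y : ℕ, (t x y).east = (t (x + 1) y).west) ∧
  (∀ x y : ℕ, (t x y).north = (t x (y + 1)).south)

/-- A quadrant tiling is non-y-recurrent if its horizontal color sequences (the ω-words
of south colors of the rows) are pairwise distinct. -/
def QuadNonYRecurrent {C : Type*} (t : ℕ → ℕ → WangTile C) : Prop :=
  ∀ y₁ y₂ : ℕ, y₁ ≠ y₂ →
    (fun x : ℕ => (t x y₁).south) ≠ (fun x : ℕ => (t x y₂).south)

/-- `Row W q u v q'`: the word `u` is transformed into `v` by a row of tiles of `W` whose
first west color is `q` and whose last east color is `q'`. -/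
def Row {C : Type*} (W : Set (WangTile C)) : C → List C → List C → C → Prop
  | q, [], v, q' => v = [] ∧ q' = q
  | q, a :: u, v, q' => ∃ t ∈ W, t.west = q ∧ t.south = a ∧
      ∃ v', v = t.north :: v' ∧ Row W t.east u v' q'

section

variable {C : Type*} {W : Set (WangTile C)}

lemma Row.length_eq {u : List C} : ∀ {q v q'}, Row W q u v q' → v.length = u.length := by
  induction u with
  | nil => rintro q v q' ⟨rfl, -⟩; rfl
  | cons a u ih =>
    rintro q v q' ⟨t, -, -, -, v', rfl, h⟩
    simp [ih h]

lemma Row.unique (hW : SWDeterministic W) {u : List C} :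
    ∀ {q v₁ q₁ v₂ q₂}, Row W q u v₁ q₁ → Row W q u v₂ q₂ → v₁ = v₂ ∧ q₁ = q₂ := by
  induction u with
  | nil => rintro q v₁ q₁ v₂ q₂ ⟨rfl, rfl⟩ ⟨rfl, rfl⟩; exact ⟨rfl, rfl⟩
  | cons a u ih =>
    rintro q v₁ q₁ v₂ q₂ ⟨t, ht, hw, hs, v, rfl, h⟩ ⟨t', ht', hw', hs', v', rfl, h'⟩
    obtain rfl := hW t ht t' ht' (hs.trans hs'.symm) (hw.trans hw'.symm)
    obtain ⟨rfl, rfl⟩ := ih h h'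
    exact ⟨rfl, rfl⟩

lemma row_append {u v : List C} : ∀ {q z q'}, Row W q (u ++ v) z q' ↔
    ∃ u' v' q₁, z = u' ++ v' ∧ Row W q u u' q₁ ∧ Row W q₁ v v' q' := by
  induction u with
  | nil =>
    intro q z q'
    constructor
    · intro h
      exact ⟨[], z, q, rfl, ⟨rfl, rfl⟩, h⟩
    · rintro ⟨u', v', q₁, rfl, ⟨rfl, rfl⟩, h⟩
      exact h
  | cons a u ih =>
    intro q z q'
    constructor
    · rintro ⟨t, ht, hw, hs, z', rfl, h⟩
      obtain ⟨u', v', q₁, rfl, h₁, h₂⟩ := ih.1 h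
      exact ⟨t.north :: u', v', q₁, rfl, ⟨t, ht, hw, hs, u', rfl, h₁⟩, h₂⟩
    · rintro ⟨w, v', q₁, rfl, ⟨t, ht, hw, hs, u', rfl, h₁⟩, h₂⟩
      exact ⟨t, ht, hw, hs, u' ++ v', rfl, ih.2 ⟨u', v', q₁, rfl, h₁, h₂⟩⟩

lemma row_singleton {q a q' : C} {v : List C} : Row W q [a] v q' ↔
    ∃ t ∈ W, t.west = q ∧ t.south = a ∧ v = [t.north] ∧ q' = t.east := by
  constructor
  · rintro ⟨t, ht, hw, hs, v', rfl, rfl, rfl⟩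
    exact ⟨t, ht, hw, hs, rfl, rfl⟩
  · rintro ⟨t, ht, hw, hs, rfl, rfl⟩
    exact ⟨t, ht, hw, hs, [], rfl, rfl, rfl⟩

/-- The prefix of length `m` of an infinite word. -/
def pre (h : ℕ → C) (m : ℕ) : List C := (List.range m).map h

@[simp] lemma length_pre (h : ℕ → C) (m : ℕ) : (pre h m).length = m := by simp [pre]

lemma pre_succ (h : ℕ → C) (m : ℕ) : pre h (m + 1) = pre h m ++ [h m] := by
  simp [pre, List.range_succ]

lemma exists_pre_append (h : ℕ → C) {m n : ℕ} (hmn : m ≤ n) : ∃ v, pre h n = pre h m ++ v := by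
  induction n, hmn using Nat.le_induction with
  | base => exact ⟨[], by simp⟩
  | succ n _ ih =>
    obtain ⟨v, hv⟩ := ih
    exact ⟨v ++ [h n], by rw [pre_succ, hv, List.append_assoc]⟩

lemma pre_inj_of_le {g h : ℕ → C} {m n : ℕ} (hmn : m ≤ n) (e : pre g n = pre h n) :
    pre g m = pre h m := by
  obtain ⟨v, hv⟩ := exists_pre_append g hmn
  obtain ⟨v', hv'⟩ := exists_pre_append h hmn
  rw [hv, hv'] at e
  exact (List.append_inj e (by simp)).1

lemma eventually_pre_ne {g h : ℕ → C} (hgh : g ≠ h) :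
    ∀ᶠ m in Filter.atTop, pre g m ≠ pre h m := by
  obtain ⟨x, hx⟩ := Function.ne_iff.1 hgh
  filter_upwards [Filter.eventually_ge_atTop (x + 1)] with m hm e
  have := pre_inj_of_le hm e
  rw [pre_succ, pre_succ] at this
  exact hx (by simpa using (List.append_inj this (by simp)).2)

lemma row_pre {r : ℕ → WangTile C} {m : ℕ} (hr : ∀ x < m, r x ∈ W)
    (he : ∀ x < m, (r x).east = (r (x + 1)).west) :
    Row W (r 0).west (pre (fun x => (r x).south) m) (pre (fun x => (r x).north) m)
      (r m).west := by
  induction m with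
  | zero => exact ⟨rfl, rfl⟩
  | succ m ih =>
    rw [pre_succ, pre_succ]
    exact row_append.2 ⟨_, _, _, rfl, ih (fun x hx => hr x (by omega)) fun x hx => he x (by omega),
      row_singleton.2 ⟨r m, hr m (by omega), rfl, rfl, rfl, (he m (by omega)).symm⟩⟩

/-- `r` is an infinite row of matching tiles of `W` transforming the infinite word `g` into `g'`. -/
def IsRow (W : Set (WangTile C)) (r : ℕ → WangTile C) (g g' : ℕ → C) : Prop :=
  (∀ x, r x ∈ W) ∧ (∀ x, (r x).east = (r (x + 1)).west) ∧
    (∀ x, (r x).south = g x) ∧ ∀ x, (r x).north = g' x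

lemma IsRow.row_pre {r : ℕ → WangTile C} {g g' : ℕ → C} (h : IsRow W r g g') (m : ℕ) :
    Row W (r 0).west (pre g m) (pre g' m) (r m).west := by
  obtain ⟨h₁, h₂, h₃, h₄⟩ := h
  obtain rfl := funext h₃
  obtain rfl := funext h₄
  exact WangTiling.row_pre (fun x _ => h₁ x) fun x _ => h₂ x

lemma exists_isRow (hW : SWDeterministic W) {q : C} {g : ℕ → C}
    (h : ∀ m, ∃ z q', Row W q (pre g m) z q') : ∃ r g', IsRow W r g g' ∧ (r 0).west = q := by
  choose z s hs using h
  have step : ∀ m, ∃ t ∈ W, t.west = s m ∧ t.south = g m ∧ t.east = s (m + 1) := by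
    intro m
    have h := hs (m + 1)
    rw [pre_succ] at h
    obtain ⟨u', v', q₁, -, h₁, h₂⟩ := row_append.1 h
    obtain ⟨-, rfl⟩ := Row.unique hW h₁ (hs m)
    obtain ⟨t, ht, hw, hsou, -, he⟩ := row_singleton.1 h₂
    exact ⟨t, ht, hw, hsou, he.symm⟩
  choose r hr hw hsou he using step
  exact ⟨r, fun x => (r x).north, ⟨hr, fun x => by rw [he, hw], hsou, fun _ => rfl⟩,
    (hw 0).trans (hs 0).2⟩

/-- `v` is obtained from `u` by stacking finitely many rows of tiles of `W`. -/
def Reach (W : Set (WangTile C)) : List C → List C → Prop :=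
  Relation.ReflTransGen fun u v => ∃ q q', Row W q u v q'

lemma Reach.length_eq {u v : List C} (h : Reach W u v) : v.length = u.length := by
  induction h with
  | refl => rfl
  | tail _ h ih =>
    obtain ⟨_, _, h⟩ := h
    rw [h.length_eq, ih]

lemma finite_reach [Finite C] (u : List C) : {v | Reach W u v}.Finite :=
  (List.finite_length_eq C u.length).subset fun _ h => h.length_eq

/-- The number of words reachable from `u`. -/
noncomputable def orbitCard (W : Set (WangTile C)) (u : List C) : ℕ := {v | Reach W u v}.ncard

/-- The extensions of `u` have unboundedly large orbits. -/
def Unbounded (W : Set (WangTile C)) (u : List C) : Prop := ∀ N, ∃ v, N < orbitCard W (u ++ v)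

/-- `φ` lifts the orbit graph of `u` to the orbit graph of the extension `u ++ v`. -/
def Lifts (W : Set (WangTile C)) (u v : List C) (φ : List C → List C) : Prop :=
  φ u = v ∧ ∀ p, Reach W u p → ∀ q p' q₁, Row W q p p' q₁ →
    ∃ q₂, Row W q (p ++ φ p) (p' ++ φ p') q₂

/-- The east colors of the rows over the lift of `p` with first west color `q`. -/
def liftEast (W : Set (WangTile C)) (u : List C) (φ : List C → List C)
    (a : {p // Reach W u p} × C) : Set C :=
  {q' | ∃ z, Row W a.2 (a.1 ++ φ a.1) z q'}

lemma Lifts.exists_of_reach (hW : SWDeterministic W) {u v x z : List C} {φ : List C → List C}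
    (hφ : Lifts W u v φ) (hz : Reach W (u ++ v ++ x) z) :
    ∃ p y, Reach W u p ∧ z = p ++ φ p ++ y ∧ ∀ v' φ', Lifts W u v' φ' →
      liftEast W u φ = liftEast W u φ' → Reach W (u ++ v' ++ x) (p ++ φ' p ++ y) := by
  induction hz with
  | refl =>
    refine ⟨u, x, .refl, by rw [hφ.1], fun v' φ' hφ' _ => ?_⟩
    rw [hφ'.1]
    exact .refl
  | tail _ h ih =>
    obtain ⟨p, y, hp, rfl, H⟩ := ih
    obtain ⟨q, q', h⟩ := h
    obtain ⟨w, y', q₂, rfl, h₁, h₂⟩ := row_append.1 h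
    obtain ⟨p', w', q₁, rfl, h₃, -⟩ := row_append.1 h₁
    obtain ⟨q₃, h₄⟩ := hφ.2 p hp q p' q₁ h₃
    obtain ⟨e, -⟩ := Row.unique hW h₁ h₄
    refine ⟨p', y', hp.tail ⟨_, _, h₃⟩, by rw [e], fun v' φ' hφ' hE => ?_⟩
    refine (H v' φ' hφ' hE).tail ⟨q, q', row_append.2 ⟨_, _, q₂, rfl, ?_, h₂⟩⟩
    have hq : q₂ ∈ liftEast W u φ (⟨p, hp⟩, q) := ⟨_, h₁⟩
    rw [hE] at hq
    obtain ⟨z, hz⟩ := hq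
    obtain ⟨q₄, h₅⟩ := hφ'.2 p hp q p' q₁ h₃
    obtain ⟨rfl, rfl⟩ := Row.unique hW hz h₅
    exact hz

lemma Lifts.orbitCard_le [Finite C] (hW : SWDeterministic W) {u v v' : List C}
    {φ φ' : List C → List C} (hφ : Lifts W u v φ) (hφ' : Lifts W u v' φ')
    (hE : liftEast W u φ = liftEast W u φ') (x : List C) :
    orbitCard W (u ++ v ++ x) ≤ orbitCard W (u ++ v' ++ x) := by
  let P : Set (List C × List C) :=
    {a | Reach W u a.1 ∧ Reach W (u ++ v' ++ x) (a.1 ++ φ' a.1 ++ a.2)}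
  have hinj : Set.InjOn (fun a : List C × List C => a.1 ++ φ' a.1 ++ a.2) P := by
    rintro ⟨p, y⟩ ⟨hp, -⟩ ⟨p', y'⟩ ⟨hp', -⟩ h
    have h : p ++ φ' p ++ y = p' ++ φ' p' ++ y' := h
    rw [List.append_assoc, List.append_assoc] at h
    obtain ⟨rfl, h⟩ := List.append_inj h (hp.length_eq.trans hp'.length_eq.symm)
    rw [List.append_cancel_left h]
  have hmaps : Set.MapsTo (fun a : List C × List C => a.1 ++ φ' a.1 ++ a.2) P
      {z | Reach W (u ++ v' ++ x) z} := fun a ha => ha.2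
  have hfin : P.Finite := Set.Finite.of_injOn hmaps hinj (finite_reach _)
  calc orbitCard W (u ++ v ++ x)
      ≤ ((fun a : List C × List C => a.1 ++ φ a.1 ++ a.2) '' P).ncard := by
        refine Set.ncard_le_ncard ?_ (hfin.image _)
        intro z hz
        obtain ⟨p, y, hp, rfl, H⟩ := hφ.exists_of_reach hW hz
        exact ⟨(p, y), ⟨hp, H v' φ' hφ' hE⟩, rfl⟩
    _ ≤ P.ncard := Set.ncard_image_le hfin
    _ ≤ orbitCard W (u ++ v' ++ x) :=
        Set.ncard_le_ncard_of_injOn _ hmaps hinj (finite_reach _)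

lemma exists_exit {P : List C → Prop} (h₀ : P []) (v : List C) (hv : ¬ P v) :
    ∃ w b x, v = w ++ [b] ++ x ∧ P w ∧ ¬ P (w ++ [b]) := by
  induction v using List.reverseRecOn with
  | nil => exact absurd h₀ hv
  | append_singleton v b ih =>
    by_cases h : P v
    · exact ⟨v, b, [], by simp, h, hv⟩
    · obtain ⟨w, b', x, rfl, h₁, h₂⟩ := ih h
      exact ⟨w, b', x ++ [b], by simp, h₁, h₂⟩

lemma Unbounded.exists_not_lifts [Finite C] (hW : SWDeterministic W) {u : List C}
    (hu : Unbounded W u) : ∃ v, Unbounded W (u ++ v) ∧ ∀ φ, ¬ Lifts W u v φ := by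
  by_contra! hcon
  choose! φ hφ using hcon
  have : Finite {p // Reach W u p} := finite_reach u
  have hB : ∀ c : ({p // Reach W u p} × C → Set C) × C, ∃ B, ∀ v, Unbounded W (u ++ v) →
      liftEast W u (φ v) = c.1 → ¬ Unbounded W (u ++ (v ++ [c.2])) →
      ∀ x, orbitCard W (u ++ (v ++ [c.2] ++ x)) ≤ B := by
    rintro ⟨E, b⟩
    by_cases hex : ∃ v, Unbounded W (u ++ v) ∧ liftEast W u (φ v) = E ∧
        ¬ Unbounded W (u ++ (v ++ [b]))
    · obtain ⟨v, hv, hE, hvb⟩ := hex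
      simp only [Unbounded, not_forall, not_exists, not_lt] at hvb
      obtain ⟨B, hB⟩ := hvb
      refine ⟨B, fun v' hv' hE' _ x => ?_⟩
      have := (hφ v' hv').orbitCard_le hW (hφ v hv) (hE'.trans hE.symm) ([b] ++ x)
      refine le_trans ?_ (this.trans (le_trans ?_ (hB x))) <;> simp
    · exact ⟨0, fun v hv hE hvb => absurd ⟨v, hv, hE, hvb⟩ hex⟩
  choose B hB using hB
  obtain ⟨M, hM⟩ := (Set.finite_range B).bddAbove
  have hB₀ : ∀ E : {p // Reach W u p} × C → Set C, ∃ N, ∀ v, Unbounded W (u ++ v) →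
      liftEast W u (φ v) = E → orbitCard W (u ++ v) ≤ N := by
    intro E
    by_cases hex : ∃ v, Unbounded W (u ++ v) ∧ liftEast W u (φ v) = E
    · obtain ⟨v, hv, hE⟩ := hex
      refine ⟨orbitCard W (u ++ v), fun v' hv' hE' => ?_⟩
      simpa using (hφ v' hv').orbitCard_le hW (hφ v hv) (hE'.trans hE.symm) []
    · exact ⟨0, fun v hv hE => absurd ⟨v, hv, hE⟩ hex⟩
  choose N hN using hB₀
  obtain ⟨M', hM'⟩ := (Set.finite_range N).bddAbove
  obtain ⟨v, hv⟩ := hu (max M M')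
  by_cases hv' : Unbounded W (u ++ v)
  · have h₁ := hN _ v hv' rfl
    have h₂ := hM' ⟨liftEast W u (φ v), rfl⟩
    exact absurd (h₁.trans (h₂.trans (le_max_right M M'))) (not_le.2 hv)
  · obtain ⟨w, b, x, rfl, hw, hwb⟩ :=
      exists_exit (P := fun v => Unbounded W (u ++ v)) (by simpa using hu) v hv'
    have h₁ := hB (liftEast W u (φ w), b) w hw rfl hwb x
    have h₂ := hM ⟨(liftEast W u (φ w), b), rfl⟩
    exact absurd (h₁.trans (h₂.trans (le_max_left M M'))) (not_le.2 hv)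

lemma exists_limit [Nonempty C] {P : List C → Prop} {Q : List C → List C → Prop} (h₀ : P [])
    (h : ∀ u, P u → ∃ v ≠ [], P (u ++ v) ∧ Q u v) :
    ∃ g : ℕ → C, ∀ m, ∃ n ≥ m, ∃ v, pre g (n + v.length) = pre g n ++ v ∧ Q (pre g n) v := by
  choose! f hne hP hQ using h
  let U : ℕ → List C := fun k => Nat.rec [] (fun _ u => u ++ f u) k
  have hU : ∀ k, U (k + 1) = U k ++ f (U k) := fun _ => rfl
  have hUP : ∀ k, P (U k) := fun k => by
    induction k with
    | zero => exact h₀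
    | succ k ih => exact hP _ ih
  have hlen : ∀ k, k ≤ (U k).length := fun k => by
    induction k with
    | zero => simp
    | succ k ih =>
      have := List.length_pos_iff.2 (hne _ (hUP k))
      rw [hU, List.length_append]
      omega
  have hpre : ∀ j k, j ≤ k → U j <+: U k := fun j k hjk => by
    induction k, hjk using Nat.le_induction with
    | base => exact List.prefix_refl _
    | succ k _ ih => exact ih.trans ⟨_, (hU k).symm⟩
  let g : ℕ → C := fun x => (U (x + 1))[x]'(hlen (x + 1))
  have hg : ∀ k, pre g (U k).length = U k := by
    intro k
    refine List.ext_getElem (by simp) fun i h₁ h₂ => ?_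
    simp only [pre, List.getElem_map, List.getElem_range, g]
    rcases le_total (i + 1) k with hk | hk
    · exact (hpre _ _ hk).getElem _
    · exact ((hpre _ _ hk).getElem _).symm
  refine ⟨g, fun m => ⟨(U m).length, hlen m, f (U m), ?_, ?_⟩⟩
  · rw [hg m, ← List.length_append]
    exact hg (m + 1)
  · rw [hg]
    exact hQ _ (hUP m)

lemma exists_injective_path {α : Type*} {r : α → α → Prop} (hfin : ∀ a, {b | r a b}.Finite)
    {a : α} (ha : {b | Relation.ReflTransGen r a b}.Infinite) :
    ∃ f : ℕ → α, Function.Injective f ∧ ∀ n, r (f n) (f (n + 1)) := by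
  let R : Set α → α → Set α := fun V x => {z | Relation.ReflTransGen (fun a b => r a b ∧ b ∉ V) x z}
  have step : ∀ p : {p : Set α × α // (R p.1 p.2).Infinite},
      ∃ p' : {p : Set α × α // (R p.1 p.2).Infinite},
        p'.1.1 = insert p.1.2 p.1.1 ∧ r p.1.2 p'.1.2 ∧ p'.1.2 ∉ p'.1.1 := by
    rintro ⟨⟨V, x⟩, hV⟩
    by_contra! hcon
    refine hV ?_
    refine ((Set.finite_singleton x).union ((hfin x).biUnion (t := fun y =>
      {z | y ∉ insert x V ∧ z ∈ R (insert x V) y}) fun y hy => ?_)).subset ?_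
    · by_cases hyV : y ∈ insert x V
      · simp [hyV]
      · by_contra hinf
        have hinf' : (R (insert x V) y).Infinite := by
          intro h
          exact hinf (h.subset fun z hz => hz.2)
        exact hyV (hcon ⟨(insert x V, y), hinf'⟩ rfl hy)
    · intro z hz
      induction hz with
      | refl => exact Or.inl rfl
      | @tail b c _ h ih =>
        by_cases hcx : c = x
        · exact Or.inl hcx
        have hc : c ∉ insert x V := by simp [hcx, h.2]
        right
        rcases ih with rfl | ih
        · exact Set.mem_biUnion (show c ∈ {y | r b y} from h.1) ⟨hc, .refl⟩
        · obtain ⟨y, hy, hyV, hyz⟩ := Set.mem_iUnion₂.1 ih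
          exact Set.mem_biUnion hy ⟨hyV, hyz.tail ⟨h.1, hc⟩⟩
  choose next h₁ h₂ h₃ using step
  let s : ℕ → {p : Set α × α // (R p.1 p.2).Infinite} := fun n =>
    Nat.rec ⟨(∅, a), by simpa [R] using ha⟩ (fun _ p => next p) n
  have hs : ∀ n, s (n + 1) = next (s n) := fun _ => rfl
  have hmem : ∀ m n, m < n → (s m).1.2 ∈ (s n).1.1 := by
    intro m n hmn
    induction n, hmn using Nat.le_induction with
    | base => rw [hs, h₁]; exact Set.mem_insert _ _
    | succ n _ ih => rw [hs, h₁]; exact Set.mem_insert_of_mem _ ih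
  have hne : ∀ m n, m < n → (s m).1.2 ≠ (s n).1.2 := by
    intro m n hmn e
    obtain ⟨k, rfl⟩ : ∃ k, n = k + 1 := ⟨n - 1, by omega⟩
    have := hmem m _ hmn
    rw [e, hs] at this
    exact h₃ _ this
  refine ⟨fun n => (s n).1.2, fun m n e => ?_, fun n => ?_⟩
  · rcases lt_trichotomy m n with h | h | h
    · exact absurd e (hne _ _ h)
    · exact h
    · exact absurd e.symm (hne _ _ h)
  · exact h₂ (s n)

/-- If finitely many infinite words are reachable from `g`, then the orbit graphs of long enough
prefixes of `g` lift to those of all longer prefixes. -/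
lemma eventually_lifts [Finite C] (hW : SWDeterministic W) {g : ℕ → C}
    (hg : {g' | Relation.ReflTransGen (fun a b => ∃ r, IsRow W r a b) g g'}.Finite) :
    ∀ᶠ n in Filter.atTop, ∀ v, pre g (n + v.length) = pre g n ++ v →
      ∃ φ, Lifts W (pre g n) v φ := by
  set R := {g' | Relation.ReflTransGen (fun a b => ∃ r, IsRow W r a b) g g'}
  have hinj : ∀ᶠ n in Filter.atTop, ∀ a ∈ R, ∀ b ∈ R, pre a n = pre b n → a = b := by
    rw [Filter.eventually_all_finite hg]
    intro a _
    rw [Filter.eventually_all_finite hg]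
    intro b _
    by_cases hab : a = b
    · simp [hab]
    · exact (eventually_pre_ne hab).mono fun n h e => absurd e h
  have hrow : ∀ᶠ n in Filter.atTop, ∀ a ∈ R, ∀ q z q', Row W q (pre a n) z q' →
      ∃ r b, IsRow W r a b ∧ (r 0).west = q := by
    rw [Filter.eventually_all_finite hg]
    intro a _
    rw [Filter.eventually_all]
    intro q
    by_cases h : ∀ m, ∃ z q', Row W q (pre a m) z q'
    · exact .of_forall fun n z q' _ => exists_isRow hW h
    · push Not at h
      obtain ⟨m, hm⟩ := h
      filter_upwards [Filter.eventually_ge_atTop m] with n hn z q' hz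
      obtain ⟨v, hv⟩ := exists_pre_append a hn
      rw [hv] at hz
      obtain ⟨u', _, q₁, -, h, -⟩ := row_append.1 hz
      exact absurd h (hm u' q₁)
  filter_upwards [hinj, hrow] with n hinj hrow v hv
  have hreach : ∀ p, Reach W (pre g n) p → ∃ a ∈ R, p = pre a n := by
    intro p hp
    induction hp with
    | refl => exact ⟨g, .refl, rfl⟩
    | tail _ h ih =>
      obtain ⟨a, ha, rfl⟩ := ih
      obtain ⟨q, q', h⟩ := h
      obtain ⟨r, b, hr, rfl⟩ := hrow a ha _ _ _ h
      exact ⟨b, ha.tail ⟨r, hr⟩, (Row.unique hW h (hr.row_pre n)).1⟩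
  have hφ : ∀ p : List C, ∃ w, ∀ a ∈ R, p = pre a n → pre a (n + v.length) = p ++ w := by
    intro p
    by_cases h : ∃ a ∈ R, p = pre a n
    · obtain ⟨a, ha, rfl⟩ := h
      obtain ⟨w, hw⟩ := exists_pre_append a (Nat.le_add_right n v.length)
      refine ⟨w, fun b hb e => ?_⟩
      rw [← hinj a ha b hb e, hw]
    · exact ⟨[], fun a ha e => absurd ⟨a, ha, e⟩ h⟩
  choose φ hφ using hφ
  refine ⟨φ, ?_, ?_⟩
  · have := hφ _ g .refl rfl
    rw [hv] at this
    exact (List.append_cancel_left this).symm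
  · intro p hp q p' q₁ h
    obtain ⟨a, ha, rfl⟩ := hreach p hp
    obtain ⟨r, b, hr, rfl⟩ := hrow a ha _ _ _ h
    obtain ⟨rfl, -⟩ := Row.unique hW h (hr.row_pre n)
    refine ⟨(r (n + v.length)).west, ?_⟩
    rw [← hφ _ a ha rfl, ← hφ _ b (ha.tail ⟨r, hr⟩) rfl]
    exact hr.row_pre _

lemma finite_isRow [Finite C] [Nonempty C] (hW : SWDeterministic W) (g : ℕ → C) :
    {g' | ∃ r, IsRow W r g g'}.Finite := by
  have : ∀ g' ∈ {g' | ∃ r, IsRow W r g g'}, ∃ q, ∃ r, IsRow W r g g' ∧ (r 0).west = q :=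
    fun g' ⟨r, hr⟩ => ⟨_, r, hr, rfl⟩
  choose! f hf using this
  refine Set.Finite.of_injOn (f := f) (Set.mapsTo_univ _ _) ?_ Set.finite_univ
  intro a ha b hb e
  obtain ⟨r, hr, hq⟩ := hf a ha
  obtain ⟨r', hr', hq'⟩ := hf b hb
  by_contra hab
  obtain ⟨m, hm⟩ := (eventually_pre_ne hab).exists
  have h := hr'.row_pre m
  rw [hq', ← e, ← hq] at h
  exact hm (Row.unique hW (hr.row_pre m) h).1

lemma Unbounded.exists_quadTiling [Finite C] [Nonempty C] (hW : SWDeterministic W)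
    (h : Unbounded W []) : ∃ t : ℕ → ℕ → WangTile C, IsQuadTiling W t ∧ QuadNonYRecurrent t := by
  obtain ⟨g, hg⟩ := exists_limit (P := Unbounded W) (Q := fun u v => ∀ φ, ¬ Lifts W u v φ) h
    fun u hu => by
      obtain ⟨v, hv, hφ⟩ := hu.exists_not_lifts hW
      refine ⟨v, ?_, hv, hφ⟩
      rintro rfl
      exact hφ (fun _ => []) ⟨rfl, fun p _ q p' q₁ hr => ⟨q₁, by simpa using hr⟩⟩
  have hinf : {g' | Relation.ReflTransGen (fun a b => ∃ r, IsRow W r a b) g g'}.Infinite := by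
    intro hfin
    obtain ⟨m, hm⟩ := Filter.eventually_atTop.1 (eventually_lifts hW hfin)
    obtain ⟨n, hn, v, hv, hnot⟩ := hg m
    obtain ⟨φ, hφ⟩ := hm n hn v hv
    exact hnot φ hφ
  obtain ⟨f, hf, hstep⟩ := exists_injective_path (finite_isRow hW) hinf
  choose r h₁ h₂ h₃ h₄ using hstep
  refine ⟨fun x y => r y x, ⟨fun x y => h₁ y x, fun x y => h₂ y x, fun x y => ?_⟩, ?_⟩
  · rw [h₄, h₃]
  · intro y₁ y₂ hne e
    simp only [h₃] at e
    exact hne (hf e)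

lemma rectRow_eq_pre (X Y : ℕ) (t : ℕ → ℕ → WangTile C) (y : ℕ) :
    rectRow X Y t y = pre (fun x => if y ≤ Y then (t x y).south else (t x Y).north) (X + 1) := by
  refine List.ext_getElem (by simp [rectRow]) fun i h₁ h₂ => ?_
  simp only [rectRow, pre, List.getElem_ofFn, List.getElem_map, List.getElem_range]

lemma pre_congr {g h : ℕ → C} {m : ℕ} (H : ∀ x < m, g x = h x) : pre g m = pre h m :=
  List.map_congr_left fun x hx => H x (List.mem_range.1 hx)

lemma IsRectTiling.row {X Y : ℕ} {t : ℕ → ℕ → WangTile C} (ht : IsRectTiling W X Y t) {y : ℕ}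
    (hy : y ≤ Y) : ∃ q q', Row W q (rectRow X Y t y) (rectRow X Y t (y + 1)) q' := by
  obtain ⟨h₁, h₂, h₃⟩ := ht
  have hs : rectRow X Y t y = pre (fun x => (t x y).south) (X + 1) := by
    simp [rectRow_eq_pre, hy]
  have hn : rectRow X Y t (y + 1) = pre (fun x => (t x y).north) (X + 1) := by
    rw [rectRow_eq_pre]
    refine pre_congr fun x hx => ?_
    split_ifs with h
    · exact (h₃ x (by omega) y (by omega)).symm
    · rw [show y = Y by omega]
  rw [hs, hn, pre_succ, pre_succ]
  exact ⟨_, _, row_append.2 ⟨_, _, _, rfl,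
    row_pre (r := fun x => t x y) (fun x hx => h₁ x hx.le y hy) (fun x hx => h₂ x hx y hy),
    row_singleton.2 ⟨t X y, h₁ X le_rfl y hy, rfl, rfl, rfl, rfl⟩⟩⟩

lemma IsRectTiling.lt_orbitCard [Finite C] {X Y : ℕ} {t : ℕ → ℕ → WangTile C}
    (ht : IsRectTiling W X Y t) (hrec : RectNonYRecurrent X Y t) :
    Y < orbitCard W (rectRow X Y t 0) := by
  have hreach : ∀ y ≤ Y + 1, Reach W (rectRow X Y t 0) (rectRow X Y t y) := by
    intro y hy
    induction y with
    | zero => exact .refl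
    | succ y ih => exact (ih (by omega)).tail (ht.row (by omega))
  have := Set.ncard_le_ncard_of_injOn (s := Set.Iic Y) (rectRow X Y t)
    (fun y hy => hreach y (Nat.le_succ_of_le hy))
    (fun a ha b hb e => by
      by_contra hab
      exact hrec a (Nat.le_succ_of_le ha) b (Nat.le_succ_of_le hb) hab e) (finite_reach (W := W) _)
  rw [Set.ncard_eq_toFinset_card', Set.toFinset_Iic, Nat.card_Iic] at this
  exact this

lemma IsQuadTiling.exists_rectNonYRecurrent {t : ℕ → ℕ → WangTile C} (ht : IsQuadTiling W t)
    (hrec : QuadNonYRecurrent t) (Y : ℕ) :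
    ∃ X, IsRectTiling W X Y t ∧ RectNonYRecurrent X Y t := by
  have hrow : ∀ X, ∀ y ≤ Y + 1, rectRow X Y t y = pre (fun x => (t x y).south) (X + 1) := by
    intro X y hy
    rw [rectRow_eq_pre]
    refine pre_congr fun x _ => ?_
    split_ifs with h
    · rfl
    · rw [ht.2.2, show y = Y + 1 by omega]
  have hev : ∀ᶠ m in Filter.atTop, ∀ y₁ ∈ Set.Iic (Y + 1), ∀ y₂ ∈ Set.Iic (Y + 1), y₁ ≠ y₂ →
      pre (fun x => (t x y₁).south) m ≠ pre (fun x => (t x y₂).south) m := by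
    rw [Filter.eventually_all_finite (Set.finite_Iic _)]
    intro y₁ _
    rw [Filter.eventually_all_finite (Set.finite_Iic _)]
    intro y₂ _
    by_cases h : y₁ = y₂
    · simp [h]
    · exact (eventually_pre_ne (hrec y₁ y₂ h)).mono fun _ h _ => h
  obtain ⟨X, hX⟩ := Filter.eventually_atTop.1 hev
  refine ⟨X, ⟨fun x _ y _ => ht.1 x y, fun x _ y _ => ht.2.1 x y, fun x _ y _ => ht.2.2 x y⟩, ?_⟩
  intro y₁ h₁ y₂ h₂ hne
  rw [hrow X y₁ h₁, hrow X y₂ h₂]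
  exact hX (X + 1) (by omega) y₁ h₁ y₂ h₂ hne

end

/-- An SW-deterministic tile set admits a non-y-recurrent tiling of the
first quadrant iff for every height `Y` it admits a non-y-recurrent tiling of some
rectangle `{0,…,X} × {0,…,Y}`. -/
theorem nonYRecurrent_quadrant_iff_rectangles {C : Type*} [Fintype C] [Nonempty C]
    (W : Set (WangTile C)) (hW : SWDeterministic W) :
    (∃ t : ℕ → ℕ → WangTile C, IsQuadTiling W t ∧ QuadNonYRecurrent t) ↔
      ∀ Y : ℕ, ∃ (X : ℕ) (t : ℕ → ℕ → WangTile C),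
        IsRectTiling W X Y t ∧ RectNonYRecurrent X Y t := by
  constructor
  · rintro ⟨t, ht, hrec⟩ Y
    obtain ⟨X, hX⟩ := ht.exists_rectNonYRecurrent hrec Y
    exact ⟨X, t, hX⟩
  · intro h
    refine Unbounded.exists_quadTiling hW fun N => ?_
    obtain ⟨X, t, ht, hrec⟩ := h N
    exact ⟨rectRow X N t 0, ht.lt_orbitCard hrec⟩

end WangTiling
end
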